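/- arXiv:2307.07848 — 7 statements merged into one kernel-verified Lean document; each statement's English description precedes it below -/
import Mathlib

section
/- Let P be a nonempty finite multiset of points in ℝ^d, let z ≥ 1 and f > 0 be reals, and let p ∈ P. Then there exists a unique r > 0 such that ∑_{x ∈ B_P(p,r)} (r^z − dist(p,x)^z) = f. -/
/-- `ballM P x r` is the sub-multiset of points of `P` within distance `r` of `x`. -/
noncomputable def ballM {d : ℕ} (P : Multiset (EuclideanSpace ℝ (Fin d)))
    (x : EuclideanSpace ℝ (Fin d)) (r : ℝ) : Multiset (EuclideanSpace ℝ (Fin d)) :=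
  P.filter (fun y => dist x y ≤ r)

theorem ballM_sum_aux {d : ℕ} (z : ℝ) (hz : 1 ≤ z) (p : EuclideanSpace ℝ (Fin d))
    (Q : Multiset (EuclideanSpace ℝ (Fin d))) :
    ∃ h : ℝ → ℝ, Continuous h ∧ MonotoneOn h (Set.Ici 0) ∧ (∀ r, 0 ≤ h r) ∧
      h 0 = 0 ∧
      ∀ r, 0 ≤ r → ((ballM Q p r).map (fun x => r ^ z - dist p x ^ z)).sum = h r := by
  have hz0 : 0 < z := by linarith
  induction Q using Multiset.induction_on with
  | empty =>
    exact ⟨fun _ => 0, continuous_const, fun _ _ _ _ _ => le_rfl, fun _ => le_rfl, rfl,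
      fun r _ => by simp [ballM]⟩
  | cons a Q ih =>
    obtain ⟨h, hc, hm, hn, h0, hs⟩ := ih
    refine ⟨fun r => max (r ^ z - dist p a ^ z) 0 + h r, ?_, ?_, ?_, ?_, ?_⟩
    · have : Continuous (fun r : ℝ => r ^ z) := Real.continuous_rpow_const hz0.le
      fun_prop
    · intro x hx y hy hxy
      have h1 : x ^ z ≤ y ^ z := Real.rpow_le_rpow hx hxy hz0.le
      have h2 := hm hx hy hxy
      exact add_le_add (max_le_max (by linarith) le_rfl) h2
    · intro r
      exact add_nonneg (le_max_right _ _) (hn r)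
    · have h1 : 0 ≤ dist p a ^ z := by positivity
      simp only [h0, Real.zero_rpow hz0.ne']
      rw [max_eq_right (by linarith)]
      simp
    · intro r hr
      have h2 := hs r hr
      unfold ballM at h2 ⊢
      beta_reduce
      by_cases hd : dist p a ≤ r
      · have h1 : dist p a ^ z ≤ r ^ z := Real.rpow_le_rpow dist_nonneg hd hz0.le
        rw [Multiset.filter_cons_of_pos (p := fun y => dist p y ≤ r) _ hd, Multiset.map_cons, Multiset.sum_cons, h2,
          max_eq_left (by linarith)]
      · have h1 : r ^ z ≤ dist p a ^ z := Real.rpow_le_rpow hr (not_le.1 hd).le hz0.le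
        rw [Multiset.filter_cons_of_neg (p := fun y => dist p y ≤ r) _ hd, h2, max_eq_right (by linarith), zero_add]

/-- There is a unique `r > 0` with `∑_{x ∈ B_P(p,r)} (r^z - dist(p,x)^z) = f`. -/
theorem exists_unique_rp {d : ℕ} (P : Multiset (EuclideanSpace ℝ (Fin d))) (hP : P ≠ 0)
    (z f : ℝ) (hz : 1 ≤ z) (hf : 0 < f)
    (p : EuclideanSpace ℝ (Fin d)) (hp : p ∈ P) :
    ∃! r : ℝ, 0 < r ∧
      ((ballM P p r).map (fun x => r ^ z - dist p x ^ z)).sum = f := by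
  have hz0 : 0 < z := by linarith
  obtain ⟨Q, rfl⟩ := Multiset.exists_cons_of_mem hp
  obtain ⟨h, hc, hm, hn, h0, hs⟩ := ballM_sum_aux z hz p Q
  have key : ∀ r, 0 ≤ r →
      ((ballM (p ::ₘ Q) p r).map (fun x => r ^ z - dist p x ^ z)).sum = r ^ z + h r := by
    intro r hr
    have h2 := hs r hr
    unfold ballM at h2 ⊢
    rw [Multiset.filter_cons_of_pos _ (by simpa using hr), Multiset.map_cons,
      Multiset.sum_cons, h2, dist_self, Real.zero_rpow hz0.ne', sub_zero]
  have hcont : Continuous (fun r : ℝ => r ^ z + h r) :=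
    (Real.continuous_rpow_const hz0.le).add hc
  have hmono : StrictMonoOn (fun r : ℝ => r ^ z + h r) (Set.Ici 0) := by
    intro x hx y hy hxy
    exact add_lt_add_of_lt_of_le (Real.rpow_lt_rpow hx hxy hz0) (hm hx hy hxy.le)
  have hR : (0:ℝ) ≤ f ^ z⁻¹ := by positivity
  have hiv := intermediate_value_Icc hR hcont.continuousOn
  obtain ⟨r, hr, hrf⟩ := hiv (show f ∈ _ from by
    have h3 := hn (f ^ z⁻¹)
    simp only [Set.mem_Icc, Real.zero_rpow hz0.ne', h0, Real.rpow_inv_rpow hf.le hz0.ne']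
    constructor <;> linarith)
  have hrpos : 0 < r := by
    rcases hr.1.eq_or_lt with h4 | h4
    · subst h4
      simp only [Real.zero_rpow hz0.ne', h0] at hrf
      linarith
    · exact h4
  refine ⟨r, ⟨hrpos, (key r hrpos.le).trans hrf⟩, ?_⟩
  rintro s ⟨hs0, hsf⟩
  rw [key s hs0.le] at hsf
  exact hmono.injOn (Set.mem_Ici.2 hs0.le) (Set.mem_Ici.2 hrpos.le) (hsf.trans hrf.symm)
end

section
/- Let P be a nonempty finite multiset of points in ℝ^d, let z ≥ 1 and f > 0 be reals, and let p, q ∈ P with r_p, r_q as in the definition. Then r_q ≤ 2^{(z−1)/z} · (r_p + dist(p,q)). -/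
/-- Smoothness of the `r_p` values: `r_q ≤ 2^((z-1)/z) (r_p + dist(p,q))`. -/
theorem rp_smooth {d : ℕ} (P : Multiset (EuclideanSpace ℝ (Fin d))) (hP : P ≠ 0)
    (z f : ℝ) (hz : 1 ≤ z) (hf : 0 < f)
    (p q : EuclideanSpace ℝ (Fin d)) (hp : p ∈ P) (hq : q ∈ P)
    (rp : ℝ) (hrp_pos : 0 < rp)
    (hrp : ((ballM P p rp).map (fun x => rp ^ z - dist p x ^ z)).sum = f)
    (rq : ℝ) (hrq_pos : 0 < rq)
    (hrq : ((ballM P q rq).map (fun x => rq ^ z - dist q x ^ z)).sum = f) :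
    rq ≤ 2 ^ ((z - 1) / z) * (rp + dist p q) := by
  by_contra hcon
  rw [not_le] at hcon
  have hz0 : 0 < z := by linarith
  have hD : 0 ≤ dist p q := dist_nonneg
  have hc1 : (1:ℝ) ≤ 2 ^ ((z - 1) / z) :=
    Real.one_le_rpow (by norm_num) (div_nonneg (by linarith) hz0.le)
  have hlt : rp + dist p q < rq := by nlinarith
  have hK : (1:ℝ) ≤ 2 ^ (z - 1) := Real.one_le_rpow (by norm_num) (by linarith)
  have hRz : (2:ℝ) ^ (z - 1) * (rp + dist p q) ^ z < rq ^ z := by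
    have h := Real.rpow_lt_rpow (by positivity) hcon hz0
    rw [Real.mul_rpow (by positivity) (by positivity), ← Real.rpow_mul (by norm_num),
      div_mul_cancel₀ _ hz0.ne'] at h
    exact h
  have hsup : rp ^ z + dist p q ^ z ≤ (rp + dist p q) ^ z :=
    Real.add_rpow_le_rpow_add hrp_pos.le hD hz
  have htri : ∀ x, dist q x ≤ dist p x + dist p q := fun x => by
    have := dist_triangle q p x
    rw [dist_comm q p] at this
    linarith
  have key : ∀ x ∈ ballM P p rp, rp ^ z - dist p x ^ z < rq ^ z - dist q x ^ z := by
    intro x hx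
    have hx' : dist p x ≤ rp := (Multiset.mem_filter.1 hx).2
    have h1 : dist q x ^ z ≤ (dist p x + dist p q) ^ z :=
      Real.rpow_le_rpow dist_nonneg (htri x) hz0.le
    have h2 : (dist p x + dist p q) ^ z ≤ 2 ^ (z - 1) * (dist p x ^ z + dist p q ^ z) :=
      by exact_mod_cast NNReal.rpow_add_le_mul_rpow_add_rpow (nndist p x) (nndist p q) hz
    have h3 : dist p x ^ z ≤ rp ^ z := Real.rpow_le_rpow dist_nonneg hx' hz0.le
    nlinarith
  have hmem : p ∈ ballM P p rp := Multiset.mem_filter.2 ⟨hp, by simpa using hrp_pos.le⟩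
  have hsum : ((ballM P p rp).map (fun x => rp ^ z - dist p x ^ z)).sum <
      ((ballM P p rp).map (fun x => rq ^ z - dist q x ^ z)).sum :=
    Multiset.sum_lt_sum (fun x hx => (key x hx).le) ⟨p, hmem, key p hmem⟩
  have hle : ballM P p rp ≤ ballM P q rq := by
    apply Multiset.monotone_filter_right
    intro x hx
    have := htri x
    linarith
  obtain ⟨t, ht⟩ := Multiset.le_iff_exists_add.1 hle
  have ht0 : 0 ≤ (t.map (fun x => rq ^ z - dist q x ^ z)).sum := by
    apply Multiset.sum_nonneg
    intro y hy
    obtain ⟨x, hx, rfl⟩ := Multiset.mem_map.1 hy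
    have hx2 : x ∈ ballM P q rq := by rw [ht]; exact Multiset.mem_add.2 (Or.inr hx)
    have := Real.rpow_le_rpow dist_nonneg (Multiset.mem_filter.1 hx2).2 hz0.le
    linarith
  rw [ht, Multiset.map_add, Multiset.sum_add] at hrq
  linarith
end

section
/- Let P be a nonempty finite multiset of points in ℝ^d, let z ≥ 1 and f > 0 be reals, let p ∈ P, and let r_p be as in the definition. Let β ≥ 1, let 0 ≤ r < r_p/(3β), and let A be a sub-multiset of P with A ⊆ B_P(p, βr). Then 2 β^z r^z · |A| < f. -/
/-- If `0 ≤ r < r_p/(3β)` and `A ⊆ B_P(p, βr)` then `2 β^z r^z |A| < f`. -/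
theorem rp_upper_count {d : ℕ} (P : Multiset (EuclideanSpace ℝ (Fin d))) (hP : P ≠ 0)
    (z f : ℝ) (hz : 1 ≤ z) (hf : 0 < f)
    (p : EuclideanSpace ℝ (Fin d)) (hp : p ∈ P)
    (rp : ℝ) (hrp_pos : 0 < rp)
    (hrp : ((ballM P p rp).map (fun x => rp ^ z - dist p x ^ z)).sum = f)
    (β : ℝ) (hβ : 1 ≤ β)
    (r : ℝ) (hr0 : 0 ≤ r) (hr : r < rp / (3 * β))
    (A : Multiset (EuclideanSpace ℝ (Fin d))) (hA : A ≤ ballM P p (β * r)) :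
    2 * β ^ z * r ^ z * (Multiset.card A : ℝ) < f := by
  have hs0 : 0 ≤ β * r := by positivity
  have h3 : 3 * (β * r) < rp := by
    rw [lt_div_iff₀ (by positivity)] at hr
    linarith
  have hz0 : 0 < z := by linarith
  have hpow : 3 * (β * r) ^ z < rp ^ z := by
    have h1 : (3 * (β * r)) ^ z < rp ^ z :=
      Real.rpow_lt_rpow (by positivity) h3 hz0
    rw [Real.mul_rpow (by norm_num) hs0] at h1
    have h2 : (3 : ℝ) ≤ 3 ^ z := Real.self_le_rpow_of_one_le (by norm_num) hz
    have h4 : 0 ≤ (β * r) ^ z := Real.rpow_nonneg hs0 z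
    nlinarith
  have hball : A ≤ ballM P p rp :=
    hA.trans (Multiset.monotone_filter_right P (fun y hy => hy.trans (by linarith)))
  have hsum : (A.map (fun x => rp ^ z - dist p x ^ z)).sum ≤ f := by
    obtain ⟨C, hC⟩ := Multiset.le_iff_exists_add.mp hball
    rw [← hrp, hC, Multiset.map_add, Multiset.sum_add]
    have : 0 ≤ (C.map (fun x => rp ^ z - dist p x ^ z)).sum := by
      apply Multiset.sum_nonneg
      intro y hy
      obtain ⟨x, hx, rfl⟩ := Multiset.mem_map.mp hy
      have hxb : x ∈ ballM P p rp := by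
        rw [hC]
        exact Multiset.mem_add.mpr (Or.inr hx)
      have hd : dist p x ≤ rp := (Multiset.mem_filter.mp hxb).2
      exact sub_nonneg.mpr (Real.rpow_le_rpow dist_nonneg hd hz0.le)
    linarith
  have hlow : (Multiset.card A : ℝ) * (rp ^ z - (β * r) ^ z)
      ≤ (A.map (fun x => rp ^ z - dist p x ^ z)).sum := by
    have h := Multiset.card_nsmul_le_sum (s := A.map (fun x => rp ^ z - dist p x ^ z))
      (a := rp ^ z - (β * r) ^ z) (by
        intro y hy
        obtain ⟨x, hx, rfl⟩ := Multiset.mem_map.mp hy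
        have hd : dist p x ≤ β * r := (Multiset.mem_filter.mp (Multiset.mem_of_le hA hx)).2
        exact sub_le_sub_left (Real.rpow_le_rpow dist_nonneg hd hz0.le) _)
    simpa [nsmul_eq_mul] using h
  have hmul : (β * r) ^ z = β ^ z * r ^ z := Real.mul_rpow (by linarith) hr0
  rw [mul_assoc 2, ← hmul]
  rcases (Nat.cast_nonneg (α := ℝ) (Multiset.card A)).eq_or_lt with h0 | h0
  · rw [← h0]
    linarith
  · nlinarith
end

section
/- Let P be a nonempty finite multiset of points in ℝ^d, let z ≥ 1 and f > 0 be reals, let p ∈ P, and let r_p be as in the definition. Let β > 1 and suppose that for every r ≥ 0 one is given a sub-multiset A^β(p,r) of P satisfying B_P(p,r) ⊆ A^β(p,r) ⊆ B_P(p, βr). Let i ∈ ℤ be such that |A^β(p, β^i)| ≥ f / (2 β^z (β^i)^z) and |A^β(p, β^{i−1})| < f / (2 β^z (β^{i−1})^z), and set r̂ = β^i (i.e., r̂ is the smallest integral power of β for which the counting condition holds). Then r_p/(3β) ≤ r̂ ≤ β · r_p. -/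
/-- Balls are monotone in the radius. -/
theorem ballM_mono_aux {d : ℕ} (P : Multiset (EuclideanSpace ℝ (Fin d)))
    (p : EuclideanSpace ℝ (Fin d)) {r s : ℝ} (h : r ≤ s) : ballM P p r ≤ ballM P p s := by
  unfold ballM
  exact Multiset.monotone_filter_right P (fun y hy => le_trans hy h)

theorem sum_upper_aux {d : ℕ} (P : Multiset (EuclideanSpace ℝ (Fin d)))
    (p : EuclideanSpace ℝ (Fin d)) (z r : ℝ) :
    ((ballM P p r).map (fun x => r ^ z - dist p x ^ z)).sum
      ≤ (Multiset.card (ballM P p r) : ℝ) * r ^ z := by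
  have h := Multiset.sum_le_card_nsmul
    ((ballM P p r).map (fun x => r ^ z - dist p x ^ z)) (r ^ z) (by
      intro x hx
      obtain ⟨y, _, rfl⟩ := Multiset.mem_map.1 hx
      have : 0 ≤ dist p y ^ z := Real.rpow_nonneg dist_nonneg z
      linarith)
  simpa using h

theorem sum_lower_aux {d : ℕ} (P : Multiset (EuclideanSpace ℝ (Fin d)))
    (p : EuclideanSpace ℝ (Fin d)) (z r t : ℝ) (hz : 0 ≤ z) (htr : t ≤ r) :
    (Multiset.card (ballM P p t) : ℝ) * (r ^ z - t ^ z)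
      ≤ ((ballM P p r).map (fun x => r ^ z - dist p x ^ z)).sum := by
  have h1 := Multiset.card_nsmul_le_sum
    (s := (ballM P p t).map (fun x => r ^ z - dist p x ^ z)) (a := r ^ z - t ^ z) (by
      intro x hx
      obtain ⟨y, hy, rfl⟩ := Multiset.mem_map.1 hx
      have hy' : dist p y ≤ t := (Multiset.mem_filter.1 hy).2
      have := Real.rpow_le_rpow dist_nonneg hy' hz
      linarith)
  obtain ⟨u, hu⟩ := Multiset.le_iff_exists_add.1 (ballM_mono_aux P p htr)
  have h2 : 0 ≤ (u.map (fun x => r ^ z - dist p x ^ z)).sum := by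
    apply Multiset.sum_nonneg
    intro x hx
    obtain ⟨y, hy, rfl⟩ := Multiset.mem_map.1 hx
    have hm : y ∈ ballM P p r := by rw [hu]; exact Multiset.mem_add.2 (Or.inr hy)
    have hy' : dist p y ≤ r := (Multiset.mem_filter.1 hm).2
    have := Real.rpow_le_rpow dist_nonneg hy' hz
    linarith
  rw [hu, Multiset.map_add, Multiset.sum_add]
  simp only [Multiset.card_map, nsmul_eq_mul] at h1
  linarith

/-- Approximating the `r_p` value from approximate ball sizes:
    if `r̂ = β^i` is the smallest integral power of `β` such that
    `|A^β(p, r̂)| ≥ f/(2 β^z r̂^z)`, then `r_p/(3β) ≤ r̂ ≤ β r_p`. -/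
theorem rp_approx {d : ℕ} (P : Multiset (EuclideanSpace ℝ (Fin d))) (hP : P ≠ 0)
    (z f : ℝ) (hz : 1 ≤ z) (hf : 0 < f)
    (p : EuclideanSpace ℝ (Fin d)) (hp : p ∈ P)
    (rp : ℝ) (hrp_pos : 0 < rp)
    (hrp : ((ballM P p rp).map (fun x => rp ^ z - dist p x ^ z)).sum = f)
    (β : ℝ) (hβ : 1 < β)
    (A : ℝ → Multiset (EuclideanSpace ℝ (Fin d)))
    (hA : ∀ r : ℝ, 0 ≤ r → ballM P p r ≤ A r ∧ A r ≤ ballM P p (β * r))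
    (i : ℤ)
    (hi1 : f / (2 * β ^ z * ((β ^ i : ℝ)) ^ z) ≤ (Multiset.card (A (β ^ i)) : ℝ))
    (hi2 : (Multiset.card (A (β ^ (i - 1))) : ℝ) < f / (2 * β ^ z * ((β ^ (i - 1) : ℝ)) ^ z)) :
    rp / (3 * β) ≤ (β ^ i : ℝ) ∧ (β ^ i : ℝ) ≤ β * rp := by
  have hβ0 : 0 < β := by linarith
  have hz0 : 0 ≤ z := by linarith
  have hR : 0 < (β ^ i : ℝ) := zpow_pos hβ0 i
  have hS : 0 < (β ^ (i - 1) : ℝ) := zpow_pos hβ0 (i - 1)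
  have hRS : (β ^ i : ℝ) = β * β ^ (i - 1) := by
    rw [zpow_sub_one₀ hβ0.ne']; field_simp
  have hA1 := (hA _ hR.le).2
  have hA2 := (hA _ hS.le).1
  generalize hRdef : (β ^ i : ℝ) = R at *
  generalize (β ^ (i - 1) : ℝ) = S at *
  constructor
  · rw [div_le_iff₀ (by positivity)]
    by_contra! hlt
    have ht : 0 < β * R := by positivity
    have hlo := sum_lower_aux P p z rp (β * R) hz0 (by nlinarith)
    rw [hrp] at hlo
    have hc : (Multiset.card (A R) : ℝ) ≤ Multiset.card (ballM P p (β * R)) := by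
      exact_mod_cast Multiset.card_le_card hA1
    rw [mul_assoc, ← Real.mul_rpow hβ0.le hR.le] at hi1
    have htz : 0 < (β * R) ^ z := Real.rpow_pos_of_pos ht z
    have h1 := (div_le_iff₀ (by positivity)).1 (hi1.trans hc)
    have h2 : (3 * (β * R)) ^ z < rp ^ z :=
      Real.rpow_lt_rpow (by positivity) (by nlinarith) (by linarith)
    rw [Real.mul_rpow (by norm_num) ht.le] at h2
    have h3 : (3 : ℝ) ≤ 3 ^ z := Real.self_le_rpow_of_one_le (by norm_num) hz
    have hcpos : 0 < (Multiset.card (ballM P p (β * R)) : ℝ) := by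
      by_contra! h
      have := mul_nonneg (neg_nonneg.2 h) htz.le
      linarith
    have h4 : 2 * (β * R) ^ z < rp ^ z - (β * R) ^ z := by nlinarith
    have := mul_lt_mul_of_pos_left h4 hcpos
    linarith
  · by_contra! hlt
    have hrS : rp < S := by
      rw [hRS] at hlt
      exact lt_of_mul_lt_mul_left hlt hβ0.le
    have hup := sum_upper_aux P p z rp
    rw [hrp] at hup
    have hc : (Multiset.card (ballM P p rp) : ℝ) ≤ Multiset.card (A S) := by
      exact_mod_cast Multiset.card_le_card ((ballM_mono_aux P p hrS.le).trans hA2)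
    have hSz : 0 < S ^ z := Real.rpow_pos_of_pos hS z
    have hbz : 1 ≤ β ^ z := Real.one_le_rpow hβ.le hz0
    have h1 := (lt_div_iff₀ (by positivity)).1 hi2
    have h2 : rp ^ z ≤ S ^ z := Real.rpow_le_rpow hrp_pos.le hrS.le hz0
    have h3 : S ^ z ≤ 2 * β ^ z * S ^ z := by nlinarith
    have h4 := mul_le_mul hc (h2.trans h3) (Real.rpow_nonneg hrp_pos.le z) (Nat.cast_nonneg _)
    linarith
end

section
/- Let U be a nonempty finite set and let g : U → [0,1] be a random function whose coordinates g(x), x ∈ U, are independent and uniformly distributed on [0,1] (i.e., g is distributed according to the product of uniform measures on [0,1]^U). Let S ⊆ U be nonempty, let a ∈ S, and let ≺ be a strict partial order on S \ {a}. Let E be the event that g is consistent with ≺, i.e., g(x) < g(y) whenever x ≺ y. Then E has positive probability and the conditional probability Pr[ g(a) = min_{s ∈ S} g(s) | E ] = 1/|S|. -/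
open MeasureTheory

namespace MinLabel

noncomputable abbrev lam : Measure ℝ := volume.restrict (Set.Icc (0:ℝ) 1)

instance : IsProbabilityMeasure lam := ⟨by simp [lam]⟩

lemma map_update {U : Type*} [Fintype U] [DecidableEq U] (a : U) :
    Measure.map (fun p : ℝ × (U → ℝ) => Function.update p.2 a p.1)
      (lam.prod (Measure.pi fun _ : U => lam)) = Measure.pi fun _ : U => lam := by
  symm
  have hm : Measurable (fun p : ℝ × (U → ℝ) => Function.update p.2 a p.1) := by
    rw [measurable_pi_iff]
    intro i
    by_cases h : i = a
    · subst h; simpa using measurable_fst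
    · simp only [Function.update_of_ne h]; fun_prop
  apply Measure.pi_eq
  intro s hs
  rw [Measure.map_apply hm (MeasurableSet.univ_pi hs)]
  have : (fun p : ℝ × (U → ℝ) => Function.update p.2 a p.1) ⁻¹' (Set.pi Set.univ s)
      = s a ×ˢ Set.pi Set.univ (Function.update s a Set.univ) := by
    ext ⟨t, g⟩
    simp only [Set.mem_preimage, Set.mem_pi, Set.mem_univ, true_implies, Set.mem_prod]
    constructor
    · intro h
      refine ⟨by simpa using h a, fun i => ?_⟩
      by_cases hi : i = a
      · subst hi; simp
      · simpa [hi] using h i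
    · rintro ⟨h1, h2⟩ i
      by_cases hi : i = a
      · subst hi; simpa using h1
      · simpa [hi] using h2 i
  rw [this, Measure.prod_prod, Measure.pi_pi, ← Finset.mul_prod_erase Finset.univ _ (Finset.mem_univ a),
    ← Finset.mul_prod_erase Finset.univ (fun i => lam (s i)) (Finset.mem_univ a)]
  simp only [Function.update_self, measure_univ, one_mul]
  congr 1
  apply Finset.prod_congr rfl
  intro i hi
  rw [Function.update_of_ne (Finset.ne_of_mem_erase hi)]

lemma scale1 (t : ℝ) (h0 : 0 ≤ t) (h1 : t < 1) (A : Set ℝ) :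
    lam (A ∩ Set.Ici t) = ENNReal.ofReal (1 - t) * lam ((fun x => t + (1 - t) * x) ⁻¹' A) := by
  have hpos : 0 < 1 - t := by linarith
  rw [Measure.restrict_apply' measurableSet_Icc, Measure.restrict_apply' measurableSet_Icc]
  have : (fun x => t + (1 - t) * x) ⁻¹' A ∩ Set.Icc (0:ℝ) 1
      = (fun x => (1 - t) * x) ⁻¹' ((fun x => t + x) ⁻¹' (A ∩ Set.Ici t ∩ Set.Icc 0 1)) := by
    ext x
    simp only [Set.mem_inter_iff, Set.mem_preimage, Set.mem_Icc, Set.mem_Ici]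
    constructor
    · rintro ⟨h, h2, h3⟩
      exact ⟨⟨h, by nlinarith⟩, by nlinarith, by nlinarith⟩
    · rintro ⟨⟨h, h2⟩, h3, h4⟩
      exact ⟨h, by nlinarith, by nlinarith⟩
  rw [this, Real.volume_preimage_mul_left hpos.ne', measure_preimage_add, ← mul_assoc,
    ← ENNReal.ofReal_mul hpos.le, abs_of_pos (inv_pos.mpr hpos), mul_inv_cancel₀ hpos.ne']
  simp

lemma scale {U : Type*} [Fintype U] [DecidableEq U] (T : Finset U) (t : ℝ) (h0 : 0 ≤ t)
    (h1 : t < 1) (E : Set (U → ℝ)) (hE : MeasurableSet E)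
    (hinv : ∀ g : U → ℝ, (fun i => if i ∈ T then t + (1 - t) * g i else g i) ∈ E ↔ g ∈ E) :
    (Measure.pi fun _ : U => lam) (E ∩ {g | ∀ s ∈ T, t ≤ g s})
      = ENNReal.ofReal (1 - t) ^ T.card * (Measure.pi fun _ : U => lam) E := by
  set μ := Measure.pi fun _ : U => lam with hμ
  set Φ : (U → ℝ) → (U → ℝ) := fun g i => if i ∈ T then t + (1 - t) * g i else g i with hΦ
  have hm : Measurable Φ := by
    rw [measurable_pi_iff]
    intro i
    by_cases h : i ∈ T <;> simp only [hΦ, h, if_true, if_false] <;> fun_prop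
  have hB : {g : U → ℝ | ∀ s ∈ T, t ≤ g s}
      = Set.pi Set.univ (fun i => if i ∈ T then Set.Ici t else Set.univ) := by
    ext g
    simp only [Set.mem_ofPred_eq, Set.mem_pi, Set.mem_univ, true_implies]
    refine forall_congr' fun i => ?_
    by_cases h : i ∈ T <;> simp [h]
  have key : ENNReal.ofReal (1 - t) ^ T.card • μ.map Φ
      = μ.restrict {g : U → ℝ | ∀ s ∈ T, t ≤ g s} := by
    rw [hB, hμ, Measure.restrict_pi_pi]
    symm
    apply Measure.pi_eq
    intro s hs
    rw [Measure.smul_apply, Measure.map_apply hm (MeasurableSet.univ_pi hs)]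
    have : Φ ⁻¹' (Set.pi Set.univ s) = Set.pi Set.univ
        (fun i => if i ∈ T then (fun x => t + (1 - t) * x) ⁻¹' (s i) else s i) := by
      ext g
      simp only [Set.mem_preimage, Set.mem_pi, Set.mem_univ, true_implies]
      refine forall_congr' fun i => ?_
      by_cases h : i ∈ T <;> simp [hΦ, h]
    rw [this, Measure.pi_pi, smul_eq_mul]
    have hc : ENNReal.ofReal (1 - t) ^ T.card
        = ∏ i : U, if i ∈ T then ENNReal.ofReal (1 - t) else 1 := by
      rw [Finset.prod_ite_mem, Finset.univ_inter, Finset.prod_const]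
    rw [hc, ← Finset.prod_mul_distrib]
    apply Finset.prod_congr rfl
    intro i _
    rw [Measure.restrict_apply (hs i)]
    by_cases h : i ∈ T
    · simp only [h, if_true]; exact (scale1 t h0 h1 _).symm
    · simp only [h, if_false, Set.inter_univ, one_mul]
  rw [← Measure.restrict_apply hE, ← key, Measure.smul_apply, Measure.map_apply hm hE, smul_eq_mul]
  congr 2
  ext g
  exact hinv g

lemma integral1 (n : ℕ) :
    ∫⁻ t, ENNReal.ofReal (1 - t) ^ n ∂lam = 1 / ((n + 1 : ℕ) : ENNReal) := by
  have h1 : ∫⁻ t, ENNReal.ofReal (1 - t) ^ n ∂lam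
      = ∫⁻ t, ENNReal.ofReal ((1 - t) ^ n) ∂lam := by
    apply setLIntegral_congr_fun measurableSet_Icc
    intro t ht
    exact (ENNReal.ofReal_pow (by linarith [ht.2]) n).symm
  rw [h1, ← ofReal_integral_eq_lintegral_ofReal]
  · rw [integral_Icc_eq_integral_Ioc, ← intervalIntegral.integral_of_le zero_le_one]
    rw [intervalIntegral.integral_comp_sub_left (fun x => x ^ n) 1]
    rw [integral_pow]
    simp only [sub_self, sub_zero, one_pow, ne_eq, Nat.succ_ne_zero, not_false_eq_true,
      zero_pow, one_div]
    rw [ENNReal.ofReal_inv_of_pos (by positivity)]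
    congr 1
    rw [← ENNReal.ofReal_natCast]; push_cast; rfl
  · exact (Continuous.integrableOn_Icc (by fun_prop))
  · filter_upwards [ae_restrict_mem measurableSet_Icc] with t ht
    exact pow_nonneg (by linarith [ht.2]) n

lemma pos {U : Type*} [Fintype U] (r : U → U → Prop) (hirr : ∀ x, ¬ r x x)
    (htrans : ∀ x y w, r x y → r y w → r x w) :
    0 < (Measure.pi fun _ : U => lam) {g : U → ℝ | ∀ x y, r x y → g x < g y} := by
  classical
  set h : U → ℕ := fun x => (Finset.univ.filter fun y => r y x).card with hh
  have hlt : ∀ x y, r x y → h x < h y := by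
    intro x y hxy
    apply Finset.card_lt_card
    rw [Finset.ssubset_iff_of_subset]
    · exact ⟨x, by simpa using hxy, by simpa using hirr x⟩
    · intro z hz
      simp only [Finset.mem_filter, Finset.mem_univ, true_and] at hz ⊢
      exact htrans _ _ _ hz hxy
  set N : ℝ := (Fintype.card U : ℝ) + 1 with hN
  have hNpos : 0 < N := by positivity
  have hle : ∀ x, (h x : ℝ) + 1 ≤ N := by
    intro x
    have : h x ≤ Fintype.card U := Finset.card_le_univ _
    have : (h x : ℝ) ≤ Fintype.card U := by exact_mod_cast this
    linarith
  have hsub : Set.pi Set.univ (fun x => Set.Ioo ((h x : ℝ) / N) (((h x : ℝ) + 1) / N))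
      ⊆ {g : U → ℝ | ∀ x y, r x y → g x < g y} := by
    intro g hg x y hxy
    have hx := (hg x trivial).2
    have hy := (hg y trivial).1
    have h2 : ((h x : ℝ) + 1) / N ≤ (h y : ℝ) / N := by
      gcongr
      exact_mod_cast hlt x y hxy
    linarith
  refine lt_of_lt_of_le ?_ (measure_mono hsub)
  rw [Measure.pi_pi, pos_iff_ne_zero, Finset.prod_ne_zero_iff]
  intro x _
  rw [Measure.restrict_apply measurableSet_Ioo, Set.inter_eq_left.mpr, Real.volume_Ioo]
  · rw [ne_eq, ENNReal.ofReal_eq_zero, not_le, sub_pos]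
    gcongr
    linarith
  · intro z hz
    have h3 : (0:ℝ) ≤ (h x : ℝ) / N := by positivity
    have h4 : ((h x : ℝ) + 1) / N ≤ 1 := by rw [div_le_one hNpos]; exact hle x
    exact ⟨by linarith [hz.1], by linarith [hz.2]⟩

end MinLabel

/-- For independent uniform labels `g : U → [0,1]`, a nonempty `S ⊆ U`, `a ∈ S`, and a
    strict partial order `≺` on `S \ {a}`, conditioned on `g` being consistent with `≺`,
    the probability that `g(a)` is the minimum of `g` over `S` is exactly `1/|S|`;
    moreover the conditioning event has positive probability. -/
theorem min_label_given_partial_order {U : Type*} [Fintype U] [Nonempty U]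
    (S : Finset U) (hS : S.Nonempty) (a : U) (ha : a ∈ S)
    (r : U → U → Prop)
    (hdom : ∀ x y, r x y → (x ∈ S ∧ x ≠ a) ∧ (y ∈ S ∧ y ≠ a))
    (hirr : ∀ x, ¬ r x x)
    (htrans : ∀ x y w, r x y → r y w → r x w) :
    0 < (Measure.pi fun _ : U => volume.restrict (Set.Icc (0:ℝ) 1))
        {g : U → ℝ | ∀ x y, r x y → g x < g y} ∧
    ProbabilityTheory.cond (Measure.pi fun _ : U => volume.restrict (Set.Icc (0:ℝ) 1))
        {g : U → ℝ | ∀ x y, r x y → g x < g y}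
        {g : U → ℝ | g a = S.inf' hS g} = 1 / (S.card : ENNReal) := by
  classical
  have hpos := MinLabel.pos r hirr htrans
  refine ⟨hpos, ?_⟩
  change ProbabilityTheory.cond (Measure.pi fun _ : U => MinLabel.lam) _ _ = _
  set μ := Measure.pi fun _ : U => MinLabel.lam with hμ
  set E := {g : U → ℝ | ∀ x y, r x y → g x < g y} with hEdef
  have hE : MeasurableSet E := by
    have : E = ⋂ x, ⋂ y, ⋂ _ : r x y, {g : U → ℝ | g x < g y} := by
      ext g; simp [hEdef]
    rw [this]
    exact MeasurableSet.iInter fun x => MeasurableSet.iInter fun y => MeasurableSet.iInter fun _ =>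
      measurableSet_lt (measurable_pi_apply x) (measurable_pi_apply y)
  set T := S.erase a with hT
  have hF : {g : U → ℝ | g a = S.inf' hS g} = {g : U → ℝ | ∀ s ∈ T, g a ≤ g s} := by
    ext g
    simp only [Set.mem_ofPred_eq]
    constructor
    · intro h s hs
      rw [h]
      exact Finset.inf'_le _ (Finset.mem_of_mem_erase hs)
    · intro h
      apply le_antisymm
      · apply Finset.le_inf'
        intro s hs
        by_cases hsa : s = a
        · rw [hsa]
        · exact h s (Finset.mem_erase.mpr ⟨hsa, hs⟩)
      · exact Finset.inf'_le _ ha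
  have hFm : MeasurableSet {g : U → ℝ | ∀ s ∈ T, g a ≤ g s} := by
    have : {g : U → ℝ | ∀ s ∈ T, g a ≤ g s} = ⋂ s, ⋂ _ : s ∈ T, {g : U → ℝ | g a ≤ g s} := by
      ext g; simp
    rw [this]
    exact MeasurableSet.iInter fun x => MeasurableSet.iInter fun _ =>
      measurableSet_le (measurable_pi_apply a) (measurable_pi_apply x)
  have hm : Measurable (fun p : ℝ × (U → ℝ) => Function.update p.2 a p.1) := by
    rw [measurable_pi_iff]
    intro i
    by_cases h : i = a
    · subst h; simpa using measurable_fst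
    · simp only [Function.update_of_ne h]; fun_prop
  have hmain : μ (E ∩ {g : U → ℝ | ∀ s ∈ T, g a ≤ g s}) = (1 / (S.card : ENNReal)) * μ E := by
    rw [hμ, ← MinLabel.map_update a, Measure.map_apply hm (hE.inter hFm),
      MinLabel.map_update a, ← hμ, Measure.prod_apply (hm (hE.inter hFm))]
    have hcard : S.card = T.card + 1 := (Finset.card_erase_add_one ha).symm
    rw [hcard, ← MinLabel.integral1, ← lintegral_mul_const _ (by fun_prop)]
    apply lintegral_congr_ae
    have hne1 : ∀ᵐ t ∂MinLabel.lam, t ≠ 1 :=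
      ae_restrict_of_ae (Measure.ae_ne volume 1)
    filter_upwards [ae_restrict_mem measurableSet_Icc, hne1] with t ht ht1
    rw [← MinLabel.scale T t ht.1 (lt_of_le_of_ne ht.2 ht1) E hE]
    · congr 1
      ext g
      simp only [Set.mem_preimage, Set.mem_inter_iff, Set.mem_ofPred_eq, hEdef,
        Function.update_self]
      refine and_congr ?_ ?_
      · refine forall_congr' fun x => forall_congr' fun y => forall_congr' fun hxy => ?_
        rw [Function.update_of_ne (hdom x y hxy).1.2, Function.update_of_ne (hdom x y hxy).2.2]
      · refine forall_congr' fun s => forall_congr' fun hs => ?_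
        rw [Function.update_of_ne (Finset.ne_of_mem_erase hs)]
    · intro g
      simp only [hEdef, Set.mem_ofPred_eq]
      refine forall_congr' fun x => forall_congr' fun y => forall_congr' fun hxy => ?_
      have hx : x ∈ T := Finset.mem_erase.mpr ⟨(hdom x y hxy).1.2, (hdom x y hxy).1.1⟩
      have hy : y ∈ T := Finset.mem_erase.mpr ⟨(hdom x y hxy).2.2, (hdom x y hxy).2.1⟩
      rw [if_pos hx, if_pos hy, add_lt_add_iff_left, mul_lt_mul_iff_right₀]
      linarith [lt_of_le_of_ne ht.2 ht1]
  rw [ProbabilityTheory.cond_apply hE, hF, hmain, mul_comm, mul_assoc,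
    ENNReal.mul_inv_cancel hpos.ne' (measure_ne_top _ _), mul_one]
end

section
/- Let P be a finite multiset of points in ℝ^d, let π : P → ℝ^d be any map, let k ≥ 1 be an integer and z ≥ 1 a real. Let Q be the multiset image {π(p) : p ∈ P} (with multiplicity). Then OPT_{k,z}(Q) ≤ 2^{z−1} · ( ∑_{p ∈ P} dist(p, π(p))^z + OPT_{k,z}(P) ). -/
/-- The optimal `(k,z)`-clustering cost of a multiset of points. -/
noncomputable def OPTkzM {d : ℕ} (P : Multiset (EuclideanSpace ℝ (Fin d)))
    (k : ℕ) (z : ℝ) : ℝ :=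
  sInf { c | ∃ C : Finset (EuclideanSpace ℝ (Fin d)), C.Nonempty ∧ C.card ≤ k ∧
      c = (P.map (fun p => Metric.infDist p (C : Set (EuclideanSpace ℝ (Fin d))) ^ z)).sum }

/-- Moving each point `p` to `π(p)` increases the optimal `(k,z)`-clustering cost to at most
    `2^(z-1) (movement cost + OPT)`. -/
theorem move_points_cost {d : ℕ} (P : Multiset (EuclideanSpace ℝ (Fin d)))
    (π : EuclideanSpace ℝ (Fin d) → EuclideanSpace ℝ (Fin d))
    (k : ℕ) (hk : 1 ≤ k) (z : ℝ) (hz : 1 ≤ z) :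
    OPTkzM (P.map π) k z ≤
      2 ^ (z - 1) * ((P.map (fun p => dist p (π p) ^ z)).sum + OPTkzM P k z) := by
  have key : ∀ C : Finset (EuclideanSpace ℝ (Fin d)), C.Nonempty → C.card ≤ k →
      OPTkzM (P.map π) k z ≤ 2 ^ (z - 1) * ((P.map (fun p => dist p (π p) ^ z)).sum +
        (P.map (fun p => Metric.infDist p (C : Set (EuclideanSpace ℝ (Fin d))) ^ z)).sum) := by
    intro C hC hCk
    have h1 : OPTkzM (P.map π) k z ≤ ((P.map π).map
        (fun p => Metric.infDist p (C : Set (EuclideanSpace ℝ (Fin d))) ^ z)).sum := by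
      apply csInf_le
      · refine ⟨0, ?_⟩
        rintro c ⟨D, -, -, rfl⟩
        apply Multiset.sum_nonneg
        intro x hx
        obtain ⟨p, -, rfl⟩ := Multiset.mem_map.1 hx
        exact Real.rpow_nonneg Metric.infDist_nonneg _
      · exact ⟨C, hC, hCk, rfl⟩
    refine h1.trans ?_
    rw [Multiset.map_map, ← Multiset.sum_map_add, ← Multiset.sum_map_mul_left]
    apply Multiset.sum_map_le_sum_map
    intro p _
    have h2 : Metric.infDist (π p) (C : Set (EuclideanSpace ℝ (Fin d))) ≤
        dist p (π p) + Metric.infDist p (C : Set (EuclideanSpace ℝ (Fin d))) := by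
      have := Metric.infDist_le_infDist_add_dist
        (s := (C : Set (EuclideanSpace ℝ (Fin d)))) (x := π p) (y := p)
      rw [dist_comm] at this
      linarith
    exact (Real.rpow_le_rpow Metric.infDist_nonneg h2 (by linarith)).trans
      (by
        have h4 := NNReal.rpow_add_le_mul_rpow_add_rpow ⟨dist p (π p), dist_nonneg⟩
          ⟨Metric.infDist p (C : Set (EuclideanSpace ℝ (Fin d))), Metric.infDist_nonneg⟩ hz
        exact_mod_cast h4)
  have hpos : (0 : ℝ) < 2 ^ (z - 1) := by positivity
  have h3 : OPTkzM (P.map π) k z / 2 ^ (z - 1) - (P.map (fun p => dist p (π p) ^ z)).sum ≤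
      OPTkzM P k z := by
    apply le_csInf
    · exact ⟨_, {0}, Finset.singleton_nonempty _, by simpa using hk, rfl⟩
    · rintro c ⟨C, hC, hCk, rfl⟩
      have := key C hC hCk
      rw [sub_le_iff_le_add, div_le_iff₀ hpos]
      linarith
  rw [sub_le_iff_le_add, div_le_iff₀ hpos] at h3
  linarith
end

section
/- Let P_w ⊂ ℝ^d be a finite set with strictly positive weights w : P_w → ℝ>0, let w' : P_w → ℝ be an injective function compatible with w in the sense that w'(a) > w'(b) implies w(a) ≥ w(b), let z ≥ 1 and ρ > 0 be reals. Suppose C ⊆ P_w is such that every p ∈ C is locally w'-maximal: for every q ∈ P_w with dist(p,q)^z · w(p) ≤ ρ one has w'(q) ≤ w'(p). Then for all distinct p, q ∈ C, dist(p,q)^z · min(w(p), w(q)) > ρ. -/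
/-- Locally `w'`-maximal points (as selected by rule (C2)) are well-separated. -/
theorem locally_maximal_separated {d : ℕ}
    (Pw : Finset (EuclideanSpace ℝ (Fin d)))
    (w : EuclideanSpace ℝ (Fin d) → ℝ) (hw : ∀ p ∈ Pw, 0 < w p)
    (w' : EuclideanSpace ℝ (Fin d) → ℝ)
    (hinj : Set.InjOn w' (Pw : Set (EuclideanSpace ℝ (Fin d))))
    (hcompat : ∀ a ∈ Pw, ∀ b ∈ Pw, w' b < w' a → w b ≤ w a)
    (z ρ : ℝ) (hz : 1 ≤ z) (hρ : 0 < ρ)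
    (C : Finset (EuclideanSpace ℝ (Fin d))) (hCsub : C ⊆ Pw)
    (hmax : ∀ p ∈ C, ∀ q ∈ Pw, dist p q ^ z * w p ≤ ρ → w' q ≤ w' p) :
    ∀ p ∈ C, ∀ q ∈ C, p ≠ q → ρ < dist p q ^ z * min (w p) (w q) := by
  intro p hp q hq hne
  have hne' : w' p ≠ w' q := fun h => hne (hinj (hCsub hp) (hCsub hq) h)
  rcases lt_or_gt_of_ne hne' with h | h
  · rw [min_eq_left (hcompat q (hCsub hq) p (hCsub hp) h)]
    by_contra hle
    exact absurd (hmax p hp q (hCsub hq) (not_lt.mp hle)) (not_le.mpr h)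
  · rw [min_eq_right (hcompat p (hCsub hp) q (hCsub hq) h), dist_comm]
    by_contra hle
    exact absurd (hmax q hq p (hCsub hp) (not_lt.mp hle)) (not_le.mpr h)
end
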